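/- arXiv:2003.07534 — 3 statements merged into one kernel-verified Lean document; each statement's English description precedes it below -/
import Mathlib

section
/- Let m be a positive even integer, let k = m/2, and let {A_1, ..., A_k} be a partition of {1, ..., m} into k sets each of size 2. Let D = (Δ_{A_1} ∪ ... ∪ Δ_{A_k}) \ {0}, where Δ_{A_i} = {v ∈ F_2^m : supp(v) ⊆ A_i}. Then the dual code C_D^⊥ has length 3m/2, dimension m/2 over F_2, and minimum distance 3. -/
open Finset

def supp {m : ℕ} (v : Fin m → ZMod 2) : Finset (Fin m) :=
  Finset.univ.filter fun i => v i ≠ 0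

def wt {m : ℕ} (v : Fin m → ZMod 2) : ℕ := (supp v).card

def delta {m : ℕ} (A : Fin m → ZMod 2) : Finset (Fin m → ZMod 2) :=
  Finset.univ.filter fun v => supp v ⊆ supp A

def deltaT {m : ℕ} (T : Finset (Fin m)) : Finset (Fin m → ZMod 2) :=
  Finset.univ.filter fun v => supp v ⊆ T

def hwt {ι : Type*} [Fintype ι] (c : ι → ZMod 2) : ℕ :=
  (Finset.univ.filter fun i => c i ≠ 0).card

def cw {m : ℕ} (D : Finset (Fin m → ZMod 2)) (u : Fin m → ZMod 2) : ↥D → ZMod 2 :=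
  fun g => ∑ i, u i * (g : Fin m → ZMod 2) i

def codeC {m : ℕ} (D : Finset (Fin m → ZMod 2)) :
    Submodule (ZMod 2) (↥D → ZMod 2) :=
  LinearMap.range (Matrix.mulVecLin (Matrix.of fun (g : ↥D) (i : Fin m) => (g : Fin m → ZMod 2) i))

def dualCode {ι : Type*} [Fintype ι] (C : Submodule (ZMod 2) (ι → ZMod 2)) :
    Submodule (ZMod 2) (ι → ZMod 2) where
  carrier := {w | ∀ c ∈ C, ∑ i, w i * c i = 0}
  zero_mem' := by simp
  add_mem' := by
    intro a b ha hb c hc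
    have h := congrArg₂ (· + ·) (ha c hc) (hb c hc)
    simpa [add_mul, Finset.sum_add_distrib] using h
  smul_mem' := by
    intro r w hw c hc
    have h := congrArg (r * ·) (hw c hc)
    simpa [Finset.mul_sum, mul_assoc] using h

def isMinDist {ι : Type*} [Fintype ι] (C : Set (ι → ZMod 2)) (d : ℕ) : Prop :=
  (∃ c ∈ C, c ≠ 0 ∧ hwt c = d) ∧ ∀ c ∈ C, c ≠ 0 → d ≤ hwt c

def chi {m : ℕ} (u v : Fin m → ZMod 2) : ℤ :=
  if supp u ∩ supp v = ∅ then 1 else 0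

theorem mem_dualCode_codeC {m : ℕ} (D : Finset (Fin m → ZMod 2)) (w : ↥D → ZMod 2) :
    w ∈ dualCode (codeC D) ↔ ∑ g, w g • (g : Fin m → ZMod 2) = 0 := by
  have key (u : Fin m → ZMod 2) :
      ∑ g, w g * ∑ i, (g : Fin m → ZMod 2) i * u i =
        ∑ i, (∑ g, w g • (g : Fin m → ZMod 2)) i * u i := by
    simp only [Finset.sum_apply, Finset.sum_mul, Finset.mul_sum, Pi.smul_apply, smul_eq_mul,
      mul_assoc]
    exact Finset.sum_comm
  constructor
  · intro hw
    ext i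
    have h := hw _ ⟨Pi.single i 1, rfl⟩
    have h' := key (Pi.single i 1)
    simp only [Pi.single_apply, mul_ite, mul_one, mul_zero, Finset.sum_ite_eq', Finset.mem_univ,
      if_true] at h'
    rw [Pi.zero_apply, ← h', ← h]
    simp
  · rintro hw _ ⟨u, rfl⟩
    exact (key u).trans (by simp only [hw, Pi.zero_apply, zero_mul, Finset.sum_const_zero])

theorem dualCode_codeC_eq_ker {m : ℕ} (D : Finset (Fin m → ZMod 2)) :
    dualCode (codeC D) = LinearMap.ker (Matrix.mulVecLin
      (Matrix.of fun (g : ↥D) (i : Fin m) => (g : Fin m → ZMod 2) i).transpose) := by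
  ext w
  rw [mem_dualCode_codeC, LinearMap.mem_ker, funext_iff, funext_iff]
  simp [Matrix.vecMul, dotProduct]

theorem finrank_dualCode_codeC_add {m : ℕ} (D : Finset (Fin m → ZMod 2))
    (h : ∀ i, Pi.single i 1 ∈ D) :
    m + Module.finrank (ZMod 2) (dualCode (codeC D)) = D.card := by
  set M : Matrix ↥D (Fin m) (ZMod 2) :=
    Matrix.of fun (g : ↥D) (i : Fin m) => (g : Fin m → ZMod 2) i with hM
  have hinj : Function.Injective M.mulVecLin := by
    rw [injective_iff_map_eq_zero]
    intro u hu
    ext i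
    simpa [hM, Matrix.mulVec] using congrFun hu ⟨_, h i⟩
  have hrank : M.transpose.rank = m := by
    rw [Matrix.rank_transpose, Matrix.rank, LinearMap.finrank_range_of_inj hinj,
      Module.finrank_fin_fun]
  have hrn := LinearMap.finrank_range_add_finrank_ker M.transpose.mulVecLin
  rw [dualCode_codeC_eq_ker]
  change M.transpose.rank + _ = _ at hrn
  rwa [hrank, Module.finrank_fintype_fun_eq_card, Fintype.card_coe] at hrn

theorem eq_one_of_ne_zero_zmod_two (a : ZMod 2) (h : a ≠ 0) : a = 1 := by
  revert a; decide

theorem add_eq_zero_iff_eq_zmod_two {m : ℕ} {v w : Fin m → ZMod 2} : v + w = 0 ↔ v = w := by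
  simp only [funext_iff, Pi.add_apply, Pi.zero_apply, CharTwo.add_eq_zero]

theorem sum_support_eq_zero {m : ℕ} {D : Finset (Fin m → ZMod 2)} {w : ↥D → ZMod 2}
    (hw : w ∈ dualCode (codeC D)) :
    ∑ g ∈ Finset.univ.filter (fun g => w g ≠ 0), (g : Fin m → ZMod 2) = 0 := by
  rw [← (mem_dualCode_codeC D w).1 hw, Finset.sum_filter]
  refine Finset.sum_congr rfl fun g _ => ?_
  split_ifs with h
  · rw [eq_one_of_ne_zero_zmod_two _ h, one_smul]
  · rw [not_not.1 h, zero_smul]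

theorem three_le_hwt {m : ℕ} {D : Finset (Fin m → ZMod 2)} (hD : 0 ∉ D) {w : ↥D → ZMod 2}
    (hw : w ∈ dualCode (codeC D)) (hne : w ≠ 0) : 3 ≤ hwt w := by
  have hsum := sum_support_eq_zero hw
  by_contra! hlt
  unfold hwt at hlt
  obtain h | h | h : (univ.filter fun g => w g ≠ 0).card = 0 ∨
      (univ.filter fun g => w g ≠ 0).card = 1 ∨
      (univ.filter fun g => w g ≠ 0).card = 2 := by omega
  · apply hne
    ext g
    simpa using Finset.filter_eq_empty_iff.1 (Finset.card_eq_zero.1 h) (Finset.mem_univ g)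
  · obtain ⟨a, ha⟩ := Finset.card_eq_one.1 h
    rw [ha, Finset.sum_singleton] at hsum
    exact hD (hsum ▸ a.2)
  · obtain ⟨a, b, hab, hs⟩ := Finset.card_eq_two.1 h
    rw [hs, Finset.sum_pair hab] at hsum
    exact hab (Subtype.ext (add_eq_zero_iff_eq_zmod_two.1 hsum))

theorem exists_mem_dualCode_hwt_eq_three {m : ℕ} {D : Finset (Fin m → ZMod 2)}
    {a b : Fin m → ZMod 2} (ha : a ∈ D) (hb : b ∈ D) (hab : a + b ∈ D)
    (hD : 0 ∉ D) (hne : a ≠ b) :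
    ∃ w ∈ dualCode (codeC D), w ≠ 0 ∧ hwt w = 3 := by
  have ha0 : a ≠ 0 := fun h => hD (h ▸ ha)
  have hb0 : b ≠ 0 := fun h => hD (h ▸ hb)
  let S : Finset ↥D := {⟨a, ha⟩, ⟨b, hb⟩, ⟨a + b, hab⟩}
  have hS1 : (⟨a, ha⟩ : ↥D) ∉ ({⟨b, hb⟩, ⟨a + b, hab⟩} : Finset ↥D) := by
    simp [hne, hb0]
  have hS2 : (⟨b, hb⟩ : ↥D) ∉ ({⟨a + b, hab⟩} : Finset ↥D) := by
    simp [ha0]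
  let w : ↥D → ZMod 2 := fun g => if g ∈ S then 1 else 0
  have hwt3 : hwt w = 3 := by
    have : (univ.filter fun g => w g ≠ 0) = S := by
      ext g
      simp [w]
    rw [hwt, this, Finset.card_insert_of_notMem hS1, Finset.card_insert_of_notMem hS2,
      Finset.card_singleton]
  refine ⟨w, ?_, ?_, hwt3⟩
  · rw [mem_dualCode_codeC]
    simp only [w, ite_smul, one_smul, zero_smul, Finset.sum_ite_mem, Finset.univ_inter]
    rw [Finset.sum_insert hS1, Finset.sum_insert hS2, Finset.sum_singleton, ← add_assoc,
      add_eq_zero_iff_eq_zmod_two]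
  · intro h
    rw [h] at hwt3
    simp [hwt] at hwt3

theorem card_deltaT {m : ℕ} (T : Finset (Fin m)) : (deltaT T).card = 2 ^ T.card := by
  rw [← Finset.card_powerset]
  refine Finset.card_bij' (fun v _ => supp v) (fun s _ => fun i => if i ∈ s then 1 else 0)
    ?_ ?_ ?_ ?_
  · simp [deltaT]
  · intro s hs
    simpa [deltaT, supp] using hs
  · intro v _
    ext i
    by_cases h : v i = 0
    · simp [supp, h]
    · simp [supp, eq_one_of_ne_zero_zmod_two _ h]
  · intro s _
    ext i
    simp [supp]

theorem single_mem_deltaT {m : ℕ} {T : Finset (Fin m)} {x : Fin m} (hx : x ∈ T) :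
    Pi.single x 1 ∈ deltaT T := by
  simp only [deltaT, supp, Finset.mem_filter, Finset.mem_univ, true_and, Finset.subset_iff]
  intro i hi
  by_cases h : i = x
  · exact h ▸ hx
  · simp [h] at hi

theorem add_mem_deltaT {m : ℕ} {T : Finset (Fin m)} {v w : Fin m → ZMod 2}
    (hv : v ∈ deltaT T) (hw : w ∈ deltaT T) : v + w ∈ deltaT T := by
  simp only [deltaT, supp, Finset.mem_filter, Finset.mem_univ, true_and, Finset.subset_iff]
    at *
  intro i hi
  by_cases h : v i = 0
  · exact hw (by simpa [h] using hi)
  · exact hv h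

theorem eq_zero_of_mem_deltaT_of_disjoint {m : ℕ} {S T : Finset (Fin m)} (h : Disjoint S T)
    {v : Fin m → ZMod 2} (hS : v ∈ deltaT S) (hT : v ∈ deltaT T) : v = 0 := by
  simp only [deltaT, supp, Finset.mem_filter, Finset.mem_univ, true_and, Finset.subset_iff]
    at hS hT
  ext i
  by_contra hi
  exact Finset.disjoint_left.1 h (hS hi) (hT hi)

theorem card_biUnion_deltaT_sdiff {m k : ℕ} (A : Fin k → Finset (Fin m))
    (hcard : ∀ i, (A i).card = 2) (hdisj : ∀ i j, i ≠ j → Disjoint (A i) (A j)) :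
    ((Finset.univ.biUnion fun i => deltaT (A i)) \ {0}).card = 3 * k := by
  have hU : (Finset.univ.biUnion fun i => deltaT (A i)) \ {0} =
      Finset.univ.biUnion fun i => deltaT (A i) \ {0} := by
    ext v
    simp
  rw [hU, Finset.card_biUnion]
  · have h3 (i : Fin k) : (deltaT (A i) \ {0}).card = 3 := by
      have h0 : {0} ⊆ deltaT (A i) := by simp [deltaT, supp]
      rw [Finset.card_sdiff_of_subset h0, card_deltaT, hcard, Finset.card_singleton]
      norm_num
    simp [h3, mul_comm]
  · intro i _ j _ hij
    rw [Function.onFun, Finset.disjoint_left]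
    intro v hi hj
    rw [Finset.mem_sdiff] at hi hj
    exact hi.2 (Finset.mem_singleton.2
      (eq_zero_of_mem_deltaT_of_disjoint (hdisj i j hij) hi.1 hj.1))

theorem stmt8 {m k : ℕ} (hm : 0 < m) (hk : m = 2 * k)
    (A : Fin k → Finset (Fin m))
    (hcard : ∀ i, (A i).card = 2)
    (hdisj : ∀ i j, i ≠ j → Disjoint (A i) (A j))
    (hcover : ∀ x : Fin m, ∃ i, x ∈ A i)
    (D : Finset (Fin m → ZMod 2))
    (hD : D = (Finset.univ.biUnion fun i => deltaT (A i)) \ {0}) :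
    D.card = 3 * m / 2 ∧
    Module.finrank (ZMod 2) (dualCode (codeC D)) = m / 2 ∧
    isMinDist (dualCode (codeC D) : Set (↥D → ZMod 2)) 3 := by
  have h0 : 0 ∉ D := by simp [hD]
  have hmem {v : Fin m → ZMod 2} (i : Fin k) (hv : v ∈ deltaT (A i)) (hv0 : v ≠ 0) : v ∈ D := by
    rw [hD, Finset.mem_sdiff, Finset.mem_biUnion, Finset.mem_singleton]
    exact ⟨⟨i, Finset.mem_univ i, hv⟩, hv0⟩
  have hsingle0 (x : Fin m) : (Pi.single x 1 : Fin m → ZMod 2) ≠ 0 := by simp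
  have hsingle (x : Fin m) : Pi.single x 1 ∈ D := by
    obtain ⟨i, hi⟩ := hcover x
    exact hmem i (single_mem_deltaT hi) (hsingle0 x)
  have hDcard : D.card = 3 * k := hD ▸ card_biUnion_deltaT_sdiff A hcard hdisj
  have hrank := finrank_dualCode_codeC_add D hsingle
  refine ⟨by omega, by omega, ?_, fun w hw hne => three_le_hwt h0 hw hne⟩
  obtain ⟨x, y, hxy, hA⟩ := Finset.card_eq_two.1 (hcard ⟨0, by omega⟩)
  have hne : (Pi.single x 1 : Fin m → ZMod 2) ≠ Pi.single y 1 := fun h => by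
    simpa [hxy] using congrFun h x
  refine exists_mem_dualCode_hwt_eq_three (hsingle x) (hsingle y) (hmem ⟨0, by omega⟩ ?_ ?_) h0 hne
  · exact add_mem_deltaT (single_mem_deltaT (by simp [hA])) (single_mem_deltaT (by simp [hA]))
  · exact fun h => hne (add_eq_zero_iff_eq_zmod_two.1 h)
end

section
/- Let A ∈ F_2^m be nonzero, list Δ_A \ {0} = {g_1, ..., g_n} with n = 2^{|A|} − 1, and let G be the m × n matrix over F_2 whose j-th column is g_j^T. Then rank(G) = |A| over F_2; moreover G G^T is the zero matrix if |A| ≥ 3, and rank(G G^T) = |A| over F_2 if |A| ∈ {1, 2}. -/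
open Finset

theorem mem_supp {m : ℕ} {v : Fin m → ZMod 2} {i : Fin m} : i ∈ supp v ↔ v i ≠ 0 := by
  simp [supp]

theorem mem_delta {m : ℕ} {A v : Fin m → ZMod 2} : v ∈ delta A ↔ ∀ i ∉ supp A, v i = 0 := by
  simp only [delta, mem_filter, mem_univ, true_and, subset_iff, mem_supp]
  exact forall_congr' fun i => by tauto

theorem ZMod.eq_one_of_ne_zero_of_two {x : ZMod 2} (hx : x ≠ 0) : x = 1 := by
  revert x; decide

/-- The product of two coordinates sums to zero over `delta A` when a third coordinate is free. -/
theorem sum_delta_mul_eq_zero {m : ℕ} {A : Fin m → ZMod 2} {i j l : Fin m}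
    (hl : l ∈ supp A) (hi : l ≠ i) (hj : l ≠ j) : ∑ v ∈ delta A, v i * v j = 0 := by
  refine Finset.sum_involution (fun v _ => v + Pi.single l 1) ?_ ?_ ?_ ?_
  · intro v _
    simp [hi.symm, hj.symm, CharTwo.add_self_eq_zero]
  · intro v _ _ h
    simpa using congrFun h l
  · intro v hv
    rw [mem_delta] at hv ⊢
    intro k hk
    have hkl : k ≠ l := by rintro rfl; exact hk hl
    simp [hv k hk, hkl]
  · intro v _
    rw [add_assoc, ← Pi.single_add, CharTwo.add_self_eq_zero, Pi.single_zero, add_zero]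

theorem sum_delta_mul_eq_one {m : ℕ} {A : Fin m → ZMod 2} {i j : Fin m}
    (hA : supp A = {i, j}) : ∑ v ∈ delta A, v i * v j = 1 := by
  have hAi : A i = 1 := ZMod.eq_one_of_ne_zero_of_two (mem_supp.1 (by simp [hA]))
  have hAj : A j = 1 := ZMod.eq_one_of_ne_zero_of_two (mem_supp.1 (by simp [hA]))
  have hAA : A ∈ delta A := mem_delta.2 fun k hk => by simpa [mem_supp] using hk
  rw [Finset.sum_eq_single_of_mem A hAA, hAi, hAj, one_mul]
  intro v hv hne
  by_contra h
  have hvi := ZMod.eq_one_of_ne_zero_of_two (left_ne_zero_of_mul h)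
  have hvj := ZMod.eq_one_of_ne_zero_of_two (right_ne_zero_of_mul h)
  refine hne (funext fun k => ?_)
  by_cases hk : k ∈ supp A
  · rw [hA, mem_insert, mem_singleton] at hk
    rcases hk with rfl | rfl
    · rw [hvi, hAi]
    · rw [hvj, hAj]
  · rw [mem_delta.1 hv k hk, mem_delta.1 hAA k hk]

theorem finrank_span_single {m : ℕ} (S : Finset (Fin m)) :
    Module.finrank (ZMod 2)
      (Submodule.span (ZMod 2) (Set.range fun i : S => (Pi.single (i : Fin m) 1 : Fin m → ZMod 2)))
      = S.card := by
  have h := (Pi.linearIndependent_single_one (Fin m) (ZMod 2)).comp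
    (fun i : S => (i : Fin m)) Subtype.val_injective
  simpa [Function.comp_def] using finrank_span_eq_card h

theorem Matrix.card_le_rank_of_col_eq_single {m n : ℕ} (M : Matrix (Fin m) (Fin n) (ZMod 2))
    (S : Finset (Fin m))
    (h : ∀ i ∈ S, ∃ j, M.col j = Pi.single i 1) : S.card ≤ M.rank := by
  rw [← finrank_span_single, Matrix.rank_eq_finrank_span_cols]
  refine Submodule.finrank_mono (Submodule.span_mono ?_)
  rintro _ ⟨i, rfl⟩
  exact h i i.2

theorem Matrix.rank_le_card_of_rows_eq_zero {m n : ℕ} (M : Matrix (Fin m) (Fin n) (ZMod 2))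
    (S : Finset (Fin m))
    (h : ∀ i ∉ S, ∀ j, M i j = 0) : M.rank ≤ S.card := by
  rw [← finrank_span_single, Matrix.rank_eq_finrank_span_cols]
  refine Submodule.finrank_mono (Submodule.span_le.2 ?_)
  rintro _ ⟨j, rfl⟩
  rw [SetLike.mem_coe, pi_eq_sum_univ' (M.col j)]
  refine Submodule.sum_mem _ fun i _ => ?_
  by_cases hi : i ∈ S
  · refine Submodule.smul_mem _ _ (Submodule.subset_span ⟨⟨i, hi⟩, ?_⟩)
    ext k
    simp [Pi.single_apply]
  · simp [Matrix.col, h i hi j]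

theorem stmt9 {m n : ℕ} (A : Fin m → ZMod 2) (hA : A ≠ 0)
    (g : Fin n → (Fin m → ZMod 2)) (hg : Function.Injective g)
    (hrange : Finset.image g Finset.univ = delta A \ {0})
    (hn : n = 2 ^ wt A - 1)
    (G : Matrix (Fin m) (Fin n) (ZMod 2)) (hG : G = Matrix.of fun i j => g j i) :
    G.rank = wt A ∧
    (3 ≤ wt A → G * G.transpose = 0) ∧
    (wt A < 3 → (G * G.transpose).rank = wt A) := by
  have hmem : ∀ v, (∃ j, g j = v) ↔ v ∈ delta A ∧ v ≠ 0 := fun v => by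
    simpa using Finset.ext_iff.1 hrange v
  have hGram : ∀ i j, (G * G.transpose) i j = ∑ v ∈ delta A, v i * v j := fun i j => by
    have h : ∑ v ∈ delta A \ {0}, v i * v j = ∑ v ∈ delta A, v i * v j :=
      Finset.sum_subset sdiff_subset fun v hv hv' => by
        have : v = 0 := by simpa [hv] using hv'
        simp [this]
    rw [← h, ← hrange, Finset.sum_image hg.injOn]
    simp [hG, Matrix.mul_apply]
  have hrank_le : G.rank ≤ wt A := G.rank_le_card_of_rows_eq_zero (supp A) fun i hi j => by
    simpa [hG] using mem_delta.1 ((hmem (g j)).1 ⟨j, rfl⟩).1 i hi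
  refine ⟨hrank_le.antisymm (G.card_le_rank_of_col_eq_single (supp A) fun i hi => ?_),
    fun h3 => ?_, fun h3 => ?_⟩
  · obtain ⟨j, hj⟩ := (hmem (Pi.single i 1)).2 ⟨mem_delta.2 fun k hk => by
      have hki : k ≠ i := by rintro rfl; exact hk hi
      simp [hki], by simp⟩
    exact ⟨j, by rw [← hj, hG]; rfl⟩
  · ext i j
    have hcard : ({i, j} : Finset (Fin m)).card < (supp A).card :=
      Finset.card_le_two.trans_lt h3
    obtain ⟨l, hl, hl'⟩ := Finset.exists_mem_notMem_of_card_lt_card hcard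
    simp only [mem_insert, mem_singleton, not_or] at hl'
    rw [hGram, sum_delta_mul_eq_zero hl hl'.1 hl'.2, Matrix.zero_apply]
  · refine ((Matrix.rank_mul_le_left _ _).trans hrank_le).antisymm
      (Matrix.card_le_rank_of_col_eq_single _ (supp A) fun i hi => ?_)
    obtain ⟨j, hj⟩ : ∃ j, supp A = {i, j} := by
      have hc : ((supp A).erase i).card ≤ 1 := by
        rw [Finset.card_erase_of_mem hi]
        exact Nat.sub_le_of_le_add (Nat.le_of_lt_succ h3)
      rcases Finset.eq_empty_or_nonempty ((supp A).erase i) with he | ⟨j, hj⟩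
      · exact ⟨i, by rw [← Finset.insert_erase hi, he]; simp⟩
      · refine ⟨j, ?_⟩
        rw [← Finset.insert_erase hi, Finset.eq_singleton_iff_unique_mem.2
          ⟨hj, fun k hk => Finset.card_le_one.1 hc k hk j hj⟩]
    refine ⟨j, funext fun k => ?_⟩
    rw [Matrix.col_apply, hGram]
    rcases eq_or_ne k i with rfl | hki
    · rw [sum_delta_mul_eq_one hj, Pi.single_eq_same]
    rw [Pi.single_eq_of_ne hki]
    by_cases hk : k ∈ supp A
    · obtain rfl : k = j := by simpa [hj, hki] using hk
      exact sum_delta_mul_eq_zero hi hki.symm hki.symm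
    · exact Finset.sum_eq_zero fun v hv => by rw [mem_delta.1 hv k hk, zero_mul]
end

section
/- Let m be a positive even integer, let k = m/2, let {A_1, ..., A_k} be a partition of {1, ..., m} into k sets each of size 2, and let D = (Δ_{A_1} ∪ ... ∪ Δ_{A_k}) \ {0}, where Δ_{A_i} = {v ∈ F_2^m : supp(v) ⊆ A_i}. Then for every u ∈ F_2^m, the Hamming weight of the codeword c_u = (u·g)_{g ∈ D} equals m − 2·|{i ∈ {1,...,k} : supp(u) ∩ A_i = ∅}|. -/
open Finset

theorem mem_deltaT {m : ℕ} {T : Finset (Fin m)} {v : Fin m → ZMod 2} :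
    v ∈ deltaT T ↔ ∀ i, v i ≠ 0 → i ∈ T := by
  simp [deltaT, subset_iff, mem_supp]

theorem hwt_cw {m : ℕ} (D : Finset (Fin m → ZMod 2)) (u : Fin m → ZMod 2) :
    hwt (cw D u) = (D.filter fun g => u ⬝ᵥ g ≠ 0).card := by
  rw [hwt, ← Finset.card_map (Function.Embedding.subtype (· ∈ D))]
  congr 1
  ext g
  simp only [Finset.mem_map, mem_filter, mem_univ, true_and]
  simp [cw, dotProduct, and_comm]

theorem card_filter_dotProduct_deltaT_pair {m : ℕ} {a b : Fin m} (hab : a ≠ b)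
    (u : Fin m → ZMod 2) :
    ((deltaT {a, b}).filter fun g => u ⬝ᵥ g ≠ 0).card =
      if u a = 0 ∧ u b = 0 then 0 else 2 := by
  have hcount : ∀ s t : ZMod 2,
      ((univ : Finset (ZMod 2 × ZMod 2)).filter fun p => s * p.1 + t * p.2 ≠ 0).card =
        if s = 0 ∧ t = 0 then 0 else 2 := by decide
  rw [← hcount (u a) (u b)]
  symm
  refine Finset.card_bij' (fun p _ => Pi.single a p.1 + Pi.single b p.2)
    (fun g _ => (g a, g b)) ?_ ?_ ?_ ?_
  · intro p hp
    rw [mem_filter, mem_deltaT]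
    refine ⟨fun i hi => ?_, ?_⟩
    · contrapose! hi
      simp only [mem_insert, mem_singleton, not_or] at hi
      simp [hi.1, hi.2]
    · simpa [dotProduct_add] using hp
  · intro g hg
    rw [mem_filter, mem_deltaT] at hg
    have hdot : u ⬝ᵥ g = u a * g a + u b * g b := by
      rw [dotProduct, ← Finset.sum_pair (f := fun i => u i * g i) hab]
      refine (Finset.sum_subset (subset_univ _) fun i _ hi => ?_).symm
      rw [not_not.mp (mt (hg.1 i) hi), mul_zero]
    simpa [hdot] using hg.2
  · intro p _
    simp [hab, hab.symm]
  · intro g hg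
    rw [mem_filter, mem_deltaT] at hg
    ext i
    by_cases hia : i = a
    · subst hia
      simp [hab]
    by_cases hib : i = b
    · subst hib
      simp [hia]
    · have : g i = 0 := by_contra fun h => by simpa [hia, hib] using hg.1 i h
      simp [hia, hib, this]

theorem card_filter_dotProduct_deltaT {m : ℕ} {T : Finset (Fin m)} (hT : T.card = 2)
    (u : Fin m → ZMod 2) :
    ((deltaT T).filter fun g => u ⬝ᵥ g ≠ 0).card = if supp u ∩ T = ∅ then 0 else 2 := by
  obtain ⟨a, b, hab, rfl⟩ := card_eq_two.mp hT
  rw [card_filter_dotProduct_deltaT_pair hab]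
  congr 1
  simp [← disjoint_iff_inter_eq_empty, mem_supp]

theorem stmt16 {m k : ℕ} (hm : 0 < m) (hk : m = 2 * k)
    (A : Fin k → Finset (Fin m))
    (hcard : ∀ i, (A i).card = 2)
    (hdisj : ∀ i j, i ≠ j → Disjoint (A i) (A j))
    (hcover : ∀ x : Fin m, ∃ i, x ∈ A i)
    (D : Finset (Fin m → ZMod 2))
    (hD : D = (Finset.univ.biUnion fun i => deltaT (A i)) \ {0})
    (u : Fin m → ZMod 2) :
    hwt (cw D u)
      = m - 2 * (Finset.univ.filter fun i => supp u ∩ A i = ∅).card := by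
  have hfilter : (D.filter fun g => u ⬝ᵥ g ≠ 0) =
      univ.biUnion fun i => (deltaT (A i)).filter fun g => u ⬝ᵥ g ≠ 0 := by
    ext g
    simp only [hD, mem_filter, mem_sdiff, mem_biUnion, mem_univ, true_and, mem_singleton]
    constructor
    · rintro ⟨⟨⟨i, hi⟩, _⟩, hu⟩
      exact ⟨i, hi, hu⟩
    · rintro ⟨i, hi, hu⟩
      refine ⟨⟨⟨i, hi⟩, ?_⟩, hu⟩
      rintro rfl
      simp at hu
  rw [hwt_cw, hfilter, card_biUnion]
  · simp only [card_filter_dotProduct_deltaT (hcard _)]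
    rw [sum_ite, sum_const_zero, zero_add, sum_const, smul_eq_mul]
    have hsplit := card_filter_add_card_filter_not (s := (univ : Finset (Fin k)))
      (fun i => supp u ∩ A i = ∅)
    rw [card_univ, Fintype.card_fin] at hsplit
    omega
  · intro i _ j _ hij
    rw [Function.onFun, disjoint_left]
    intro g hi hj
    rw [mem_filter, mem_deltaT] at hi hj
    have hg : g = 0 := by
      ext x
      by_contra hx
      exact disjoint_left.mp (hdisj i j hij) (hi.1 x hx) (hj.1 x hx)
    exact hi.2 (by simp [hg])
end
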